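/- arXiv:1110.4833 — 5 statements merged into one kernel-verified Lean document; each statement's English description precedes it below -/
import Mathlib

section
/- For every smooth compactly supported function f : ℝ³ → ℝ, the integral over ℝ³ (with respect to Lebesgue measure) of the inner product ⟨∇f(x), x/(4π‖x‖³)⟩ equals −f(0). (Equivalently, the distributional divergence of the vector field ω(x) = x/(4π‖x‖³) is the Dirac delta at the origin.) -/
open MeasureTheory
open scoped RealInnerProductSpace

open Set Metric in
lemma aux_integrable (f : EuclideanSpace ℝ (Fin 3) → ℝ)
    (hf : ContDiff ℝ (⊤ : ℕ∞) f) (hsupp : HasCompactSupport f) :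
    Integrable (fun x : EuclideanSpace ℝ (Fin 3) =>
      fderiv ℝ f x ((4 * Real.pi * ‖x‖ ^ 3)⁻¹ • x)) := by
  have hc : Continuous (fderiv ℝ f) := hf.continuous_fderiv (by simp)
  have hs : HasCompactSupport (fderiv ℝ f) := hsupp.fderiv ℝ
  obtain ⟨C, hC⟩ := hc.bounded_above_of_compact_support hs
  obtain ⟨R, hR⟩ := hs.isCompact.isBounded.subset_ball (0 : EuclideanSpace ℝ (Fin 3))
  have hmeas : Measurable (fun x : EuclideanSpace ℝ (Fin 3) =>
      fderiv ℝ f x ((4 * Real.pi * ‖x‖ ^ 3)⁻¹ • x)) := by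
    have h1 : Measurable (fun x : EuclideanSpace ℝ (Fin 3) => fderiv ℝ f x x) :=
      (hc.clm_apply continuous_id).measurable
    simp only [map_smul, smul_eq_mul]
    fun_prop
  have hb : IntegrableOn (fun x : EuclideanSpace ℝ (Fin 3) =>
      C * ((4 * Real.pi)⁻¹ * (‖x‖ ^ 2)⁻¹)) (ball 0 R) := by
    rw [integrableOn_fun_norm_addHaar volume (f := fun y => C * ((4 * Real.pi)⁻¹ * (y ^ 2)⁻¹))]
    have : IntegrableOn (fun _ : ℝ => C * (4 * Real.pi)⁻¹) (Ioo 0 R) :=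
      integrableOn_const (by simp)
    refine this.congr_fun (fun y hy => ?_) measurableSet_Ioo
    have : y ≠ 0 := hy.1.ne'
    simp
    field_simp
  have : IntegrableOn (fun x : EuclideanSpace ℝ (Fin 3) =>
      fderiv ℝ f x ((4 * Real.pi * ‖x‖ ^ 3)⁻¹ • x)) (ball 0 R) := by
    refine hb.mono' hmeas.aestronglyMeasurable (Filter.Eventually.of_forall fun x => ?_)
    refine ((fderiv ℝ f x).le_opNorm _).trans ?_
    have h0 : 0 ≤ C := (norm_nonneg _).trans (hC x)
    refine mul_le_mul (hC x) ?_ (norm_nonneg _) h0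
    rw [norm_smul, norm_inv, Real.norm_of_nonneg (by positivity)]
    by_cases hx : ‖x‖ = 0
    · simp [hx]
    · apply le_of_eq
      field_simp
  refine (integrableOn_iff_integrable_of_support_subset ?_).1 this
  intro x hx
  apply hR
  apply subset_tsupport
  intro h
  apply hx
  simp [h]

open Set Metric in
lemma aux_ray (f : EuclideanSpace ℝ (Fin 3) → ℝ)
    (hf : ContDiff ℝ (⊤ : ℕ∞) f) (hsupp : HasCompactSupport f)
    (s : EuclideanSpace ℝ (Fin 3)) (hs : ‖s‖ = 1) :
    ∫ r : Ioi (0 : ℝ), fderiv ℝ f (r.1 • s) ((4 * Real.pi * ‖r.1 • s‖ ^ 3)⁻¹ • (r.1 • s))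
      ∂(Measure.volumeIoiPow 2) = (4 * Real.pi)⁻¹ * (- f 0) := by
  have hs0 : s ≠ 0 := by rintro rfl; simp at hs
  have hg : ContDiff ℝ 1 (fun r : ℝ => f (r • s)) :=
    (hf.of_le (by exact_mod_cast le_top)).comp (contDiff_id.smul contDiff_const)
  have hgs : HasCompactSupport (fun r : ℝ => f (r • s)) :=
    hsupp.comp_isClosedEmbedding (isClosedEmbedding_smul_left hs0)
  have key := hgs.integral_Ioi_deriv_eq hg 0
  simp only [zero_smul] at key
  rw [← key, ← integral_const_mul]
  simp only [Measure.volumeIoiPow, ENNReal.ofReal]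
  rw [integral_withDensity_eq_integral_smul (measurable_subtype_coe.pow_const _).real_toNNReal,
    integral_subtype_comap measurableSet_Ioi fun a : ℝ ↦ Real.toNNReal (a ^ 2) •
      fderiv ℝ f (a • s) ((4 * Real.pi * ‖a • s‖ ^ 3)⁻¹ • (a • s))]
  refine setIntegral_congr_fun measurableSet_Ioi fun r hr => ?_
  have hr : 0 < r := hr
  have hd : deriv (fun r : ℝ => f (r • s)) r = fderiv ℝ f (r • s) s := by
    have h1 : HasDerivAt (fun r : ℝ => r • s) s r := by
      simpa using (hasDerivAt_id r).smul_const s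
    exact ((hf.differentiable (by simp) (r • s)).hasFDerivAt.comp_hasDerivAt r h1).deriv
  simp only [hd, NNReal.smul_def, Real.coe_toNNReal _ (pow_nonneg hr.le 2), map_smul, norm_smul,
    hs, Real.norm_of_nonneg hr.le, smul_eq_mul, mul_one]
  field_simp

/-- For every smooth compactly supported `f : ℝ³ → ℝ`, the integral over ℝ³
(Lebesgue measure) of `⟨∇f(x), x/(4π‖x‖³)⟩` equals `−f 0`; i.e. the distributional divergence
of `ω x = x/(4π‖x‖³)` is the Dirac delta at the origin. -/
theorem stmt_1 (f : EuclideanSpace ℝ (Fin 3) → ℝ)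
    (hf : ContDiff ℝ (⊤ : ℕ∞) f) (hsupp : HasCompactSupport f) :
    ∫ x : EuclideanSpace ℝ (Fin 3),
      ⟪gradient f x, (4 * Real.pi * ‖x‖ ^ 3)⁻¹ • x⟫ = - f 0 := by
  have hint := aux_integrable f hf hsupp
  simp only [gradient, InnerProductSpace.toDual_symm_apply]
  set G : EuclideanSpace ℝ (Fin 3) → ℝ := fun x =>
      fderiv ℝ f x ((4 * Real.pi * ‖x‖ ^ 3)⁻¹ • x) with hG
  set μ : Measure (EuclideanSpace ℝ (Fin 3)) := volume with hμ
  have hmp := μ.measurePreserving_homeomorphUnitSphereProd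
  have hemb := (homeomorphUnitSphereProd (EuclideanSpace ℝ (Fin 3))).measurableEmbedding
  have hdim : Module.finrank ℝ (EuclideanSpace ℝ (Fin 3)) - 1 = 2 := by simp
  rw [hdim] at hmp
  have hcomp : (fun p : Metric.sphere (0 : EuclideanSpace ℝ (Fin 3)) 1 × Set.Ioi (0 : ℝ) =>
      G (p.2.1 • p.1.1)) ∘ homeomorphUnitSphereProd (EuclideanSpace ℝ (Fin 3))
      = G ∘ Subtype.val := by
    funext x
    have hx : ‖x.1‖ ≠ 0 := norm_ne_zero_iff.2 x.2
    simp [smul_smul, hx]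
  have hI : Integrable (fun p : Metric.sphere (0 : EuclideanSpace ℝ (Fin 3)) 1 × Set.Ioi (0 : ℝ) =>
      G (p.2.1 • p.1.1)) (μ.toSphere.prod (Measure.volumeIoiPow 2)) := by
    rw [← hmp.integrable_comp_emb hemb, hcomp,
      ← integrableOn_iff_comap_subtypeVal (measurableSet_singleton _).compl]
    exact hint.integrableOn
  have h1 : ∫ x, G x ∂μ = ∫ p : Metric.sphere (0 : EuclideanSpace ℝ (Fin 3)) 1 × Set.Ioi (0 : ℝ),
      G (p.2.1 • p.1.1) ∂(μ.toSphere.prod (Measure.volumeIoiPow 2)) := by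
    rw [← hmp.integral_comp hemb]
    have := fun x => congrFun hcomp x
    simp only [Function.comp_apply] at this
    simp only [this]
    rw [integral_subtype_comap (measurableSet_singleton _).compl G, restrict_compl_singleton]
  rw [h1, integral_prod _ hI]
  have h2 : ∀ s : Metric.sphere (0 : EuclideanSpace ℝ (Fin 3)) 1,
      ∫ r : Set.Ioi (0 : ℝ), G (r.1 • s.1) ∂(Measure.volumeIoiPow 2)
        = (4 * Real.pi)⁻¹ * (- f 0) := fun s =>
    aux_ray f hf hsupp s.1 (by simp)
  simp only [h2, integral_const, Measure.toSphere_real_apply_univ]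
  have hv : μ.real (Metric.ball 0 1) = 4 / 3 * Real.pi := by
    rw [hμ, measureReal_def, EuclideanSpace.volume_ball_fin_three]
    simp
    rw [ENNReal.toReal_ofReal (by positivity)]
    ring
  rw [hv]
  simp
  field_simp
end

section
/- Let e be an invertible 3×3 real matrix (entries e^k_a, first index internal, second spatial) and K a 3×3 real matrix (entries K^j_a). If for all i, a, b in Fin 3 one has Σ_{j,k} ε(i,j,k) · (K^j_a · e^k_b − K^j_b · e^k_a) = 0, then K = 0. (Pointwise algebraic core of the lemma: for an invertible frame field, vanishing torsion forces the extrinsic curvature to vanish.) -/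
/-- The Levi-Civita symbol on `Fin 3`: `levicivita i j k` is the sign of the permutation
`(i,j,k)` when the indices are pairwise distinct, and `0` otherwise. -/
def levicivita : Fin 3 → Fin 3 → Fin 3 → ℝ :=
  ![![![0, 0, 0], ![0, 0, 1], ![0, -1, 0]],
    ![![0, 0, -1], ![0, 0, 0], ![1, 0, 0]],
    ![![0, 1, 0], ![-1, 0, 0], ![0, 0, 0]]]

/-- Pointwise algebraic core of "vanishing torsion forces vanishing extrinsic
curvature": if `e` is an invertible 3×3 real matrix and `K` a 3×3 real matrix with
`Σ_{j,k} ε(i,j,k)·(K j a · e k b − K j b · e k a) = 0` for all `i, a, b`, then `K = 0`. -/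
theorem stmt_4 (e K : Matrix (Fin 3) (Fin 3) ℝ) (he : IsUnit e)
    (h : ∀ i a b : Fin 3,
      ∑ j : Fin 3, ∑ k : Fin 3, levicivita i j k * (K j a * e k b - K j b * e k a) = 0) :
    K = 0 := by
  have hdet : IsUnit e.det := (Matrix.isUnit_iff_isUnit_det e).mp he
  obtain ⟨f, hf⟩ : ∃ f, f = e⁻¹ := ⟨_, rfl⟩
  have hef : e * f = 1 := by rw [hf]; exact Matrix.mul_nonsing_inv e hdet
  have hfe : f * e = 1 := by rw [hf]; exact Matrix.nonsing_inv_mul e hdet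
  -- contract both spatial indices with the inverse frame
  have key : ∀ i c d : Fin 3, ∑ j : Fin 3, ∑ k : Fin 3, levicivita i j k *
      ((K * f) j c * (e * f) k d - (K * f) j d * (e * f) k c) = 0 := by
    intro i c d
    have h2 : ∑ a : Fin 3, ∑ b : Fin 3, (∑ j : Fin 3, ∑ k : Fin 3,
        levicivita i j k * (K j a * e k b - K j b * e k a)) * (f a c * f b d) = 0 := by
      simp only [h, zero_mul, Finset.sum_const_zero]
    rw [← h2]
    simp only [Matrix.mul_apply, Fin.sum_univ_three]
    ring
  rw [hef] at key
  obtain ⟨M, hM⟩ : ∃ M, M = K * f := ⟨_, rfl⟩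
  rw [← hM] at key
  have hM0 : M = 0 := by
    have k1 := fun i => key i 0 1
    have k2 := fun i => key i 0 2
    have k3 := fun i => key i 1 2
    simp [Fin.forall_fin_succ, Fin.sum_univ_three, levicivita, Matrix.one_apply] at k1 k2 k3
    ext i j
    fin_cases i <;> fin_cases j <;> simp <;> grind
  calc K = K * f * e := by rw [Matrix.mul_assoc, hfe, Matrix.mul_one]
    _ = 0 := by rw [← hM, hM0, Matrix.zero_mul]
end

section
/- Let e be an invertible 3×3 real matrix with inverse ẽ = e⁻¹, and let K be any 3×3 real matrix. Define M^a_i := det(e) · Σ_{b,j} K^j_b · (ẽ^a_i · ẽ^b_j − ẽ^a_j · ẽ^b_i). Then for all i, a in Fin 3: K^i_a = (1/det(e)) · Σ_{d,j} ( (1/2) · e^i_a · e^j_d − e^i_d · e^j_a ) · M^d_j. (Explicit inversion expressing the extrinsic curvature in terms of the torsion of the frame field.) -/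
/-- Let `e` be an invertible 3×3 real matrix with inverse `ẽ = e⁻¹` and `K` any
3×3 real matrix. With `M a i := det e · Σ_{b,j} K j b · (ẽ a i · ẽ b j − ẽ a j · ẽ b i)`,
one has `K i a = (1/det e) · Σ_{d,j} ((1/2)·e i a·e j d − e i d·e j a) · M d j`. -/
theorem stmt_5 (e K M : Matrix (Fin 3) (Fin 3) ℝ) (he : IsUnit e)
    (hM : ∀ a i : Fin 3, M a i = e.det * ∑ b : Fin 3, ∑ j : Fin 3,
      K j b * (e⁻¹ a i * e⁻¹ b j - e⁻¹ a j * e⁻¹ b i))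
    (i a : Fin 3) :
    K i a = (1 / e.det) * ∑ d : Fin 3, ∑ j : Fin 3,
      ((1 / 2) * e i a * e j d - e i d * e j a) * M d j := by
  have hd : IsUnit e.det := (Matrix.isUnit_iff_isUnit_det e).1 he
  have hd0 : e.det ≠ 0 := hd.ne_zero
  have h1 : e * e⁻¹ = 1 := Matrix.mul_nonsing_inv e hd
  have h2 : e⁻¹ * e = 1 := Matrix.nonsing_inv_mul e hd
  generalize e⁻¹ = f at *
  have hM' : M = e.det • ((K * f).trace • f - f * K * f) := by
    ext a i
    rw [hM a i]
    simp only [Matrix.smul_apply, Matrix.sub_apply, Matrix.mul_apply, Matrix.trace,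
      Matrix.diag_apply, smul_eq_mul, Fin.sum_univ_three]
    ring
  have hR : ∑ d : Fin 3, ∑ j : Fin 3, ((1 / 2) * e i a * e j d - e i d * e j a) * M d j
      = (1 / 2) * e i a * (e * M).trace - (e * M * e) i a := by
    simp only [Matrix.mul_apply, Matrix.trace, Matrix.diag_apply, Fin.sum_univ_three]
    ring
  have heM : e * M = e.det • ((K * f).trace • (1 : Matrix (Fin 3) (Fin 3) ℝ) - K * f) := by
    rw [hM', Matrix.mul_smul, Matrix.mul_sub, Matrix.mul_smul, h1, Matrix.mul_assoc f K f,
      ← Matrix.mul_assoc e f, h1, Matrix.one_mul]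
  have ht : (e * M).trace = e.det * (2 * (K * f).trace) := by
    rw [heM, Matrix.trace_smul, Matrix.trace_sub, Matrix.trace_smul, Matrix.trace_one]
    simp only [smul_eq_mul, Fintype.card_fin]
    push_cast
    ring
  have heMe : e * M * e = e.det • ((K * f).trace • e - K) := by
    rw [heM, Matrix.smul_mul, Matrix.sub_mul, Matrix.smul_mul, Matrix.one_mul,
      Matrix.mul_assoc K f e, h2, Matrix.mul_one]
  rw [hR, ht, heMe]
  simp only [Matrix.smul_apply, Matrix.sub_apply, smul_eq_mul]
  field_simp
  ring
end

section
/- Let E be a real normed vector space, a : E → Matrix (Fin n) (Fin n) ℝ continuously differentiable with a(x) invertible for every x, A(x)(v) := a(x) * (fderiv ℝ (fun y ↦ (a y)⁻¹) x v), and let z : E → Matrix (Fin n) (Fin n) ℝ be twice continuously differentiable. Define the frame field ē(x)(v) := a(x) * (fderiv ℝ z x v) * (a(x))⁻¹. Then the covariant torsion of ē vanishes: for all x, u, v, fderiv ℝ (fun y ↦ ē(y)(v)) x u − fderiv ℝ (fun y ↦ ē(y)(u)) x v + (A(x)(u) * ē(x)(v) − ē(x)(v) * A(x)(u)) − (A(x)(v)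 * ē(x)(u) − ē(x)(u) * A(x)(v)) = 0. (A frame field of the flat form ē = a · dz · a⁻¹ is torsion-free with respect to the pure-gauge connection A = a·d(a⁻¹).) -/
attribute [local instance] Matrix.normedAddCommGroup Matrix.normedSpace

lemma hasFDerivAt_matMul {E : Type*} [NormedAddCommGroup E] [NormedSpace ℝ E] {n : ℕ}
    {f g : E → Matrix (Fin n) (Fin n) ℝ} {x : E}
    (hf : DifferentiableAt ℝ f x) (hg : DifferentiableAt ℝ g x) :
    DifferentiableAt ℝ (fun y => f y * g y) x ∧
    ∀ u, fderiv ℝ (fun y => f y * g y) x u = f x * fderiv ℝ g x u + fderiv ℝ f x u * g x := by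
  have h := (LinearMap.toContinuousBilinearMap
    (LinearMap.mul ℝ (Matrix (Fin n) (Fin n) ℝ))).hasFDerivAt_of_bilinear
      hf.hasFDerivAt hg.hasFDerivAt
  have h2 : HasFDerivAt (fun y => f y * g y) _ x := h
  refine ⟨h2.differentiableAt, fun u => ?_⟩
  rw [h2.fderiv]
  rfl

lemma differentiableAt_matDet {E : Type*} [NormedAddCommGroup E] [NormedSpace ℝ E] {n : ℕ}
    {f : E → Matrix (Fin n) (Fin n) ℝ} {x : E}
    (hf : ∀ i j, DifferentiableAt ℝ (fun y => f y i j) x) :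
    DifferentiableAt ℝ (fun y => (f y).det) x := by
  simp only [Matrix.det_apply]
  refine DifferentiableAt.fun_sum fun σ _ => ?_
  have : DifferentiableAt ℝ (fun y => ∏ i, f y (σ i) i) x :=
    (HasFDerivAt.finsetProd (u := Finset.univ) (g := fun i y => f y (σ i) i)
      (fun i _ => (hf (σ i) i).hasFDerivAt)).differentiableAt
  exact this.const_smul _

lemma differentiableAt_matEntry {E : Type*} [NormedAddCommGroup E] [NormedSpace ℝ E] {n : ℕ}
    {f : E → Matrix (Fin n) (Fin n) ℝ} {x : E} :
    DifferentiableAt ℝ f x ↔ ∀ i j, DifferentiableAt ℝ (fun y => f y i j) x :=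
  (differentiableAt_pi (Φ := f)).trans (forall_congr' fun i =>
    differentiableAt_pi (Φ := fun y => f y i))

lemma differentiableAt_matInv {E : Type*} [NormedAddCommGroup E] [NormedSpace ℝ E] {n : ℕ}
    {f : E → Matrix (Fin n) (Fin n) ℝ} {x : E}
    (hf : DifferentiableAt ℝ f x) (hu : IsUnit (f x)) :
    DifferentiableAt ℝ (fun y => (f y)⁻¹) x := by
  rw [differentiableAt_matEntry] at hf ⊢
  intro i j
  have hd : (f x).det ≠ 0 := ((Matrix.isUnit_iff_isUnit_det _).1 hu).ne_zero
  simp only [Matrix.inv_def, Matrix.smul_apply, smul_eq_mul, Ring.inverse_eq_inv',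
    Matrix.adjugate_apply]
  refine ((differentiableAt_matDet hf).inv hd).mul (differentiableAt_matDet fun k l => ?_)
  simp only [Matrix.updateRow_apply]
  split_ifs
  · exact differentiableAt_const _
  · exact hf _ _

/-- A frame field of the flat form `ē = a · dz · a⁻¹` is torsion-free with
respect to the pure-gauge connection `A = a · d(a⁻¹)`: with `a` C¹ and pointwise invertible and
`z` C², the covariant torsion `dē + [A, ē]` (antisymmetrized in the two directions) vanishes. -/
theorem stmt_9 {E : Type*} [NormedAddCommGroup E] [NormedSpace ℝ E] {n : ℕ}
    (a : E → Matrix (Fin n) (Fin n) ℝ) (ha : ContDiff ℝ 1 a)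
    (hinv : ∀ x, IsUnit (a x))
    (A : E → E → Matrix (Fin n) (Fin n) ℝ)
    (hA : ∀ x v, A x v = a x * fderiv ℝ (fun y => (a y)⁻¹) x v)
    (z : E → Matrix (Fin n) (Fin n) ℝ) (hz : ContDiff ℝ 2 z)
    (eb : E → E → Matrix (Fin n) (Fin n) ℝ)
    (heb : ∀ x v, eb x v = a x * fderiv ℝ z x v * (a x)⁻¹)
    (x u v : E) :
    fderiv ℝ (fun y => eb y v) x u - fderiv ℝ (fun y => eb y u) x v
      + (A x u * eb x v - eb x v * A x u) - (A x v * eb x u - eb x u * A x v) = 0 := by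
  have had : DifferentiableAt ℝ a x := (ha.differentiable (by norm_num)) x
  have hb := differentiableAt_matInv had (hinv x)
  have hdet : IsUnit (a x).det := (Matrix.isUnit_iff_isUnit_det _).1 (hinv x)
  have hzd : DifferentiableAt ℝ (fderiv ℝ z) x :=
    (hz.fderiv_right (m := 1) (by norm_num)).differentiable (by norm_num) x
  have hsymm : fderiv ℝ (fderiv ℝ z) x u v = fderiv ℝ (fderiv ℝ z) x v u :=
    (hz.contDiffAt.isSymmSndFDerivAt (by simp)) u v
  have hzw : ∀ w, DifferentiableAt ℝ (fun y => fderiv ℝ z y w) x := fun w =>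
    hzd.clm_apply (differentiableAt_const w)
  have hzwd : ∀ w t, fderiv ℝ (fun y => fderiv ℝ z y w) x t = fderiv ℝ (fderiv ℝ z) x t w := by
    intro w t
    have h := (ContinuousLinearMap.apply ℝ (Matrix (Fin n) (Fin n) ℝ) w).hasFDerivAt.comp x
      hzd.hasFDerivAt
    have hder : HasFDerivAt (fun y => fderiv ℝ z y w) _ x := h
    exact congrArg (fun L => L t) hder.fderiv
  have hone : ∀ t, a x * fderiv ℝ (fun y => (a y)⁻¹) x t = - (fderiv ℝ a x t * (a x)⁻¹) := by
    intro t
    have h := (hasFDerivAt_matMul had hb).2 t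
    have hc : (fun y => a y * (a y)⁻¹) = fun _ => (1 : Matrix (Fin n) (Fin n) ℝ) :=
      funext fun y => Matrix.mul_nonsing_inv _ ((Matrix.isUnit_iff_isUnit_det _).1 (hinv y))
    rw [hc] at h
    have h0 : fderiv ℝ (fun _ : E => (1 : Matrix (Fin n) (Fin n) ℝ)) x t = 0 := by
      simp
    rw [h0] at h
    exact eq_neg_of_add_eq_zero_left h.symm
  have key : ∀ t w, fderiv ℝ (fun y => eb y w) x t + (A x t * eb x w - eb x w * A x t)
      = a x * fderiv ℝ (fderiv ℝ z) x t w * (a x)⁻¹ := by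
    intro t w
    have he : (fun y => eb y w) = fun y => a y * fderiv ℝ z y w * (a y)⁻¹ :=
      funext fun y => heb y w
    have h1 := hasFDerivAt_matMul had (hzw w)
    have h3 : A x t * eb x w = - (fderiv ℝ a x t * fderiv ℝ z x w * (a x)⁻¹) := by
      rw [hA, hone, heb, neg_mul]
      simp only [Matrix.mul_assoc, Matrix.nonsing_inv_mul_cancel_left _ _ hdet]
    have h4 : eb x w * A x t
        = a x * fderiv ℝ z x w * fderiv ℝ (fun y => (a y)⁻¹) x t := by
      rw [hA, heb]
      simp only [Matrix.mul_assoc, Matrix.nonsing_inv_mul_cancel_left _ _ hdet]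
    rw [h3, h4, he, (hasFDerivAt_matMul h1.1 hb).2 t, h1.2 t, hzwd, add_mul]
    abel
  have e1 := key u v
  have e2 := key v u
  rw [hsymm, ← e2] at e1
  rw [← sub_eq_zero] at e1
  rw [← e1]
  abel
end

section
/- Let E be a real normed vector space and z : E → Matrix (Fin n) (Fin n) ℝ twice continuously differentiable. Define the matrix-valued two-form X(x)(v,w) := ⁅fderiv ℝ z x v, fderiv ℝ z x w⁆ (matrix commutator). Then X is closed: for all x ∈ E and all directions u, v, w ∈ E, fderiv ℝ (fun y ↦ X(y)(v,w)) x u + fderiv ℝ (fun y ↦ X(y)(w,u)) x v + fderiv ℝ (fun y ↦ X(y)(u,v)) x w = 0. (The two-form [dz, dz] is closed; this is the Gauss law for the electric field built from a flat frame field.) -/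
attribute [local instance] Matrix.normedAddCommGroup Matrix.normedSpace

theorem aux_deriv {E : Type*} [NormedAddCommGroup E] [NormedSpace ℝ E] {n : ℕ}
    (z : E → Matrix (Fin n) (Fin n) ℝ) (hz : ContDiff ℝ 2 z) (x u v w : E) :
    fderiv ℝ (fun y => ⁅fderiv ℝ z y v, fderiv ℝ z y w⁆) x u
      = ⁅fderiv ℝ (fderiv ℝ z) x u v, fderiv ℝ z x w⁆
        + ⁅fderiv ℝ z x v, fderiv ℝ (fderiv ℝ z) x u w⁆ := by
  have hd : DifferentiableAt ℝ (fderiv ℝ z) x :=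
    ((hz.fderiv_right (m := 1) (by norm_num)).differentiable (by norm_num)) x
  have h1 : ∀ a : E, HasFDerivAt (fun y => fderiv ℝ z y a)
      ((ContinuousLinearMap.apply ℝ _ a).comp (fderiv ℝ (fderiv ℝ z) x)) x := fun a =>
    (ContinuousLinearMap.apply ℝ (Matrix (Fin n) (Fin n) ℝ) a).hasFDerivAt.comp x hd.hasFDerivAt
  let M := Matrix (Fin n) (Fin n) ℝ
  let B0 : M →ₗ[ℝ] M →ₗ[ℝ] M := LinearMap.mul ℝ M - (LinearMap.mul ℝ M).flip
  let B : M →L[ℝ] M →L[ℝ] M := LinearMap.toContinuousLinearMap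
    ((LinearMap.toContinuousLinearMap (𝕜 := ℝ) (E := M) (F' := M)).toLinearMap ∘ₗ B0)
  have hB : ∀ p q : M, B p q = ⁅p, q⁆ := fun p q => rfl
  have h2 := (B.hasFDerivAt_of_bilinear (h1 v) (h1 w)).fderiv
  have h3 := congrArg (fun L => L u) h2
  rw [add_comm]
  exact h3

/-- For `z : E → Matrix (Fin n) (Fin n) ℝ` twice continuously differentiable,
the matrix-valued two-form `X x (v, w) := ⁅dz(x)v, dz(x)w⁆` is closed: the cyclic sum of its
directional derivatives vanishes. (The two-form `[dz, dz]` is closed: the Gauss law.) -/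
theorem stmt_10 {E : Type*} [NormedAddCommGroup E] [NormedSpace ℝ E] {n : ℕ}
    (z : E → Matrix (Fin n) (Fin n) ℝ) (hz : ContDiff ℝ 2 z)
    (X : E → E → E → Matrix (Fin n) (Fin n) ℝ)
    (hX : ∀ x v w, X x v w = ⁅fderiv ℝ z x v, fderiv ℝ z x w⁆)
    (x u v w : E) :
    fderiv ℝ (fun y => X y v w) x u + fderiv ℝ (fun y => X y w u) x v
      + fderiv ℝ (fun y => X y u v) x w = 0 := by
  have hs : IsSymmSndFDerivAt ℝ z x := hz.contDiffAt.isSymmSndFDerivAt (by simp)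
  simp only [hX, aux_deriv z hz]
  have e : ∀ a b : E, fderiv ℝ (fderiv ℝ z) x a b = fderiv ℝ (fderiv ℝ z) x b a :=
    fun a b => hs.eq a b
  rw [e u v, e w v, e u w]
  simp only [Ring.lie_def]
  abel
end
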